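/- arXiv:1510.06951 — 7 statements merged into one kernel-verified Lean document; each statement's English description precedes it below -/
import Mathlib

section
/- For every real κ with κ > −1 and κ ≠ 0, the integral of the coupled logarithm of the reciprocal over the unit interval is invariant to the coupling: ∫_0^1 ln_κ(x^{−1}) dx = 1. -/
open MeasureTheory Real

/-- The integral over the unit interval of the coupled logarithm of the reciprocal
is invariant to the coupling: `∫_0^1 ln_κ(x⁻¹) dx = 1`. -/
theorem integral_coupled_log_inv_unit_interval (κ : ℝ) (h1 : -1 < κ) (h0 : κ ≠ 0) :
    (∫ x in Set.Ioo (0 : ℝ) 1, (1 / κ) * ((x⁻¹) ^ (κ / (1 + κ)) - 1)) = 1 := by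
  have hpos : 0 < 1 + κ := by linarith
  have hexp : -(κ / (1 + κ)) + 1 = (1 + κ)⁻¹ := by
    field_simp
    ring
  have hr : -1 < -(κ / (1 + κ)) := by
    have := inv_pos.mpr hpos
    linarith
  calc (∫ x in Set.Ioo (0 : ℝ) 1, (1 / κ) * ((x⁻¹) ^ (κ / (1 + κ)) - 1))
      = ∫ x in Set.Ioo (0 : ℝ) 1, (1 / κ) * (x ^ (-(κ / (1 + κ))) - 1) := by
        refine setIntegral_congr_fun measurableSet_Ioo fun x hx => ?_
        simp only [inv_rpow hx.1.le, rpow_neg hx.1.le]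
    _ = ∫ x in (0 : ℝ)..1, (1 / κ) * (x ^ (-(κ / (1 + κ))) - 1) := by
        rw [intervalIntegral.integral_of_le zero_le_one, integral_Ioc_eq_integral_Ioo]
    _ = 1 := by
        rw [intervalIntegral.integral_const_mul,
          intervalIntegral.integral_sub (intervalIntegral.intervalIntegrable_rpow' hr)
            intervalIntegrable_const,
          integral_rpow (Or.inl hr), hexp, one_rpow, zero_rpow (inv_ne_zero hpos.ne')]
        simp [h0]
end

section
/- Let κ > 0 and σ > 0, and let f(x) = (1/σ)·(1 + κ·x/σ)^{−(1+κ)/κ} for x ≥ 0 be the coupled exponential density. Then the coupled first moment equals the scale: ( ∫_0^∞ x·f(x)^{(1+2κ)/(1+κ)} dx ) / ( ∫_0^∞ f(x)^{(1+2κ)/(1+κ)} dx ) = σ. -/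
open MeasureTheory Real

lemma hasDerivAt_one_add_mul_rpow {c s x : ℝ} (hc : 0 < c) (hs : 1 < s) (hx : 0 ≤ x) :
    HasDerivAt (fun y : ℝ => -(1 / (c * (s - 1))) * (1 + c * y) ^ (-(s - 1)))
      ((1 + c * x) ^ (-s)) x := by
  have hpos : 0 < 1 + c * x := by positivity
  have hs' : s - 1 ≠ 0 := by linarith
  have hlin : HasDerivAt (fun y : ℝ => 1 + c * y) c x := by
    simpa using ((hasDerivAt_id x).const_mul c).const_add 1
  refine ((hlin.rpow_const (p := -(s - 1)) (Or.inl hpos.ne')).const_mul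
    (-(1 / (c * (s - 1))))).congr_deriv ?_
  rw [show -(s - 1) - 1 = -s by ring]
  field_simp

lemma tendsto_one_add_mul_rpow_neg {c s : ℝ} (hc : 0 < c) (hs : 1 < s) :
    Filter.Tendsto (fun y : ℝ => -(1 / (c * (s - 1))) * (1 + c * y) ^ (-(s - 1)))
      Filter.atTop (nhds 0) := by
  have hlin : Filter.Tendsto (fun y : ℝ => 1 + c * y) Filter.atTop Filter.atTop :=
    Filter.tendsto_atTop_add_const_left _ _ (Filter.tendsto_id.const_mul_atTop hc)
  simpa using ((tendsto_rpow_neg_atTop (sub_pos.mpr hs)).comp hlin).const_mul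
    (-(1 / (c * (s - 1))))

lemma one_add_mul_rpow_nonneg {c x : ℝ} (hc : 0 < c) (hx : 0 < x) (s : ℝ) :
    0 ≤ (1 + c * x) ^ s := by
  positivity

lemma integrableOn_Ioi_one_add_mul_rpow_neg {c s : ℝ} (hc : 0 < c) (hs : 1 < s) :
    IntegrableOn (fun x : ℝ => (1 + c * x) ^ (-s)) (Set.Ioi 0) :=
  integrableOn_Ioi_deriv_of_nonneg' (fun _ hx => hasDerivAt_one_add_mul_rpow hc hs hx)
    (fun _ hx => one_add_mul_rpow_nonneg hc hx _) (tendsto_one_add_mul_rpow_neg hc hs)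

lemma integral_Ioi_one_add_mul_rpow_neg {c s : ℝ} (hc : 0 < c) (hs : 1 < s) :
    ∫ x in Set.Ioi (0 : ℝ), (1 + c * x) ^ (-s) = 1 / (c * (s - 1)) := by
  rw [integral_Ioi_of_hasDerivAt_of_nonneg'
    (fun _ hx => hasDerivAt_one_add_mul_rpow hc hs hx)
    (fun _ hx => one_add_mul_rpow_nonneg hc hx _) (tendsto_one_add_mul_rpow_neg hc hs)]
  simp

lemma integral_Ioi_mul_one_add_mul_rpow_neg {c s : ℝ} (hc : 0 < c) (hs : 2 < s) :
    ∫ x in Set.Ioi (0 : ℝ), x * (1 + c * x) ^ (-s) =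
      1 / (c ^ 2 * ((s - 1) * (s - 2))) := by
  have hsplit : Set.EqOn (fun x : ℝ => x * (1 + c * x) ^ (-s))
      (fun x => 1 / c * ((1 + c * x) ^ (-(s - 1)) - (1 + c * x) ^ (-s))) (Set.Ioi 0) := by
    intro x hx
    have hx' : 0 < x := hx
    have hpos : 0 < 1 + c * x := by positivity
    have hadd : (1 + c * x) ^ (-(s - 1)) = (1 + c * x) ^ (-s) * (1 + c * x) := by
      rw [← rpow_add_one hpos.ne']
      congr 1
      ring
    simp only [hadd]
    field_simp
    ring
  have hs₁ : s - 1 ≠ 0 := by linarith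
  have hs₂ : s - 2 ≠ 0 := by linarith
  rw [setIntegral_congr_fun measurableSet_Ioi hsplit, integral_const_mul,
    integral_sub (integrableOn_Ioi_one_add_mul_rpow_neg hc (by linarith))
      (integrableOn_Ioi_one_add_mul_rpow_neg hc (by linarith)),
    integral_Ioi_one_add_mul_rpow_neg hc (by linarith),
    integral_Ioi_one_add_mul_rpow_neg hc (by linarith), show s - 1 - 1 = s - 2 by ring]
  field_simp
  ring

/-- For the coupled exponential density, the coupled (escort) first moment equals the
scale: `(∫_0^∞ x·f(x)^{(1+2κ)/(1+κ)} dx) / (∫_0^∞ f(x)^{(1+2κ)/(1+κ)} dx) = σ`. -/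
theorem coupledExponential_coupled_first_moment (κ σ : ℝ) (hκ : 0 < κ) (hσ : 0 < σ)
    (f : ℝ → ℝ) (hf : f = fun x => (1 / σ) * (1 + κ * x / σ) ^ (-(1 + κ) / κ)) :
    (∫ x in Set.Ici (0 : ℝ), x * f x ^ ((1 + 2 * κ) / (1 + κ))) /
        (∫ x in Set.Ici (0 : ℝ), f x ^ ((1 + 2 * κ) / (1 + κ))) = σ := by
  have hescort : ∀ x ∈ Set.Ioi (0 : ℝ), f x ^ ((1 + 2 * κ) / (1 + κ)) =
      (1 / σ) ^ ((1 + 2 * κ) / (1 + κ)) * (1 + κ / σ * x) ^ (-(2 + 1 / κ)) := by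
    intro x hx
    have hx' : 0 < x := hx
    have hpos : 0 < 1 + κ / σ * x := by positivity
    rw [hf]
    dsimp only
    rw [show 1 + κ * x / σ = 1 + κ / σ * x by ring, mul_rpow (by positivity) (by positivity),
      ← rpow_mul hpos.le]
    congr 2
    field_simp
    ring
  have hc : 0 < κ / σ := by positivity
  have hs : 2 < 2 + 1 / κ := lt_add_of_pos_right 2 (by positivity)
  have hC : 0 < (1 / σ) ^ ((1 + 2 * κ) / (1 + κ)) := by positivity
  rw [integral_Ici_eq_integral_Ioi, integral_Ici_eq_integral_Ioi,
    setIntegral_congr_fun measurableSet_Ioi hescort,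
    setIntegral_congr_fun (g := fun x => (1 / σ) ^ ((1 + 2 * κ) / (1 + κ)) *
      (x * (1 + κ / σ * x) ^ (-(2 + 1 / κ)))) measurableSet_Ioi
      (fun x hx => by simp only [hescort x hx]; ring),
    integral_const_mul, integral_const_mul, mul_div_mul_left _ _ hC.ne',
    integral_Ioi_mul_one_add_mul_rpow_neg hc hs,
    integral_Ioi_one_add_mul_rpow_neg hc (by linarith),
    show 2 + 1 / κ - 1 = (κ + 1) / κ by field_simp; ring,
    show 2 + 1 / κ - 2 = 1 / κ by ring]
  field_simp
end

section
/- Let κ > 0, α > 0, set κ₁ = −ακ/(1+κ), and let w_1, …, w_N be nonnegative weights with Σ w_i = 1 and x_1, …, x_N positive reals. Then the coupled-log average can be expressed via the coupled product of coupled powers: exp_κ^{−1/α}( Σ_{i=1}^N w_i·ln_κ(x_i^{−α}) ) = ∏^{⊗_{κ₁}}_{i=1}^N x_i^{⊗_{κ₁} w_i}, i.e. both sides equal ( Σ_{i=1}^N (w_i·x_i^{κ₁} − (w_i − 1)) − (N − 1) )^{1/κ₁} = ( Σ_{i=1}^N w_i·x_i^{κ₁} )^{1/κ₁}. -/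
open Real

/-- The coupled-log average equals the coupled product of coupled powers, and both
equal `(Σᵢ wᵢ·xᵢ^{κ₁})^{1/κ₁}` with `κ₁ = −ακ/(1+κ)`. -/
theorem coupledLogAverage_eq_coupledProduct (κ α : ℝ) (hκ : 0 < κ) (hα : 0 < α)
    (κ₁ : ℝ) (hκ₁ : κ₁ = -(α * κ) / (1 + κ)) (N : ℕ) (w x : Fin N → ℝ)
    (hw : ∀ i, 0 ≤ w i) (hw1 : ∑ i, w i = 1) (hx : ∀ i, 0 < x i) :
    (max 0 (1 + κ * ∑ i, w i * ((1 / κ) * ((x i ^ (-α)) ^ (κ / (1 + κ)) - 1)))) ^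
          (-(1 + κ) / (α * κ)) =
        (max 0 ((∑ i, ((max 0 (w i * x i ^ κ₁ - (w i - 1))) ^ (1 / κ₁)) ^ κ₁) -
            ((N : ℝ) - 1))) ^ (1 / κ₁) ∧
      (max 0 ((∑ i, ((max 0 (w i * x i ^ κ₁ - (w i - 1))) ^ (1 / κ₁)) ^ κ₁) -
            ((N : ℝ) - 1))) ^ (1 / κ₁) =
        ((∑ i, (w i * x i ^ κ₁ - (w i - 1))) - ((N : ℝ) - 1)) ^ (1 / κ₁) ∧
      ((∑ i, (w i * x i ^ κ₁ - (w i - 1))) - ((N : ℝ) - 1)) ^ (1 / κ₁) =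
        (∑ i, w i * x i ^ κ₁) ^ (1 / κ₁) := by
  have hκ₁_ne : κ₁ ≠ 0 := by
    rw [hκ₁]
    exact div_ne_zero (neg_ne_zero.mpr (by positivity)) (by positivity)
  have hexp : -(1 + κ) / (α * κ) = 1 / κ₁ := by
    rw [hκ₁, one_div_div, div_neg, neg_div]
  have hpow (i : Fin N) : (x i ^ (-α)) ^ (κ / (1 + κ)) = x i ^ κ₁ := by
    rw [← rpow_mul (hx i).le, hκ₁]
    congr 1
    ring
  have hsum_nonneg : 0 ≤ ∑ i, w i * x i ^ κ₁ :=
    Finset.sum_nonneg fun i _ => mul_nonneg (hw i) (rpow_nonneg (hx i).le _)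
  have hw_le (i : Fin N) : w i ≤ 1 :=
    hw1 ▸ Finset.single_le_sum (fun j _ => hw j) (Finset.mem_univ i)
  have hfactor (i : Fin N) :
      ((max 0 (w i * x i ^ κ₁ - (w i - 1))) ^ (1 / κ₁)) ^ κ₁ =
        w i * x i ^ κ₁ - (w i - 1) := by
    have hnonneg : 0 ≤ w i * x i ^ κ₁ := mul_nonneg (hw i) (rpow_nonneg (hx i).le _)
    rw [← rpow_mul (le_max_left _ _), one_div_mul_cancel hκ₁_ne, rpow_one,
      max_eq_right (by linarith [hw_le i])]
  have hprod : (∑ i, (w i * x i ^ κ₁ - (w i - 1))) - ((N : ℝ) - 1) =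
      ∑ i, w i * x i ^ κ₁ := by
    simp [Finset.sum_sub_distrib, hw1]
    ring
  have hlog : 1 + κ * ∑ i, w i * ((1 / κ) * (x i ^ κ₁ - 1)) = ∑ i, w i * x i ^ κ₁ := by
    have hterm (i : Fin N) :
        κ * (w i * ((1 / κ) * (x i ^ κ₁ - 1))) = w i * x i ^ κ₁ - w i := by
      field_simp
    simp only [Finset.mul_sum, hterm, Finset.sum_sub_distrib, hw1]
    ring
  simp only [hpow, hfactor, hprod, hlog, hexp, max_eq_right hsum_nonneg, and_self]
end

section
/- Let κ > 0, σ > 0, μ ∈ ℝ, and let f(x) = (1/σ)·(1 + κ·(x−μ)/σ)^{−(1+κ)/κ} for x ≥ μ be the coupled exponential density. With m = κ/(1+κ), the coupled average uncertainty of f satisfies f_{κavg} = ( ∫_μ^∞ f(x)^{1+m} dx )^{1/m} = (1/σ)·(1+κ)^{−(1+κ)/κ} = f(μ + σ); that is, the coupled average uncertainty equals the density evaluated at the location plus the scale. -/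
open MeasureTheory Real

theorem integral_Ioi_one_add_mul_sub_rpow {a b : ℝ} (ha : a < -1) (hb : 0 < b) (c : ℝ) :
    ∫ x in Set.Ioi c, (1 + b * (x - c)) ^ a = -(b * (a + 1))⁻¹ := by
  have ha' : a + 1 ≠ 0 := by linarith
  have hpos : ∀ x ∈ Set.Ici c, 0 < 1 + b * (x - c) := fun x hx => by
    have := mul_nonneg hb.le (sub_nonneg.2 (Set.mem_Ici.1 hx))
    linarith
  have hderiv : ∀ x ∈ Set.Ici c, HasDerivAt
      (fun x => (b * (a + 1))⁻¹ * (1 + b * (x - c)) ^ (a + 1)) ((1 + b * (x - c)) ^ a) x := by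
    intro x hx
    have h := ((((hasDerivAt_id x).sub_const c).const_mul b).const_add 1).rpow_const
      (p := a + 1) (Or.inl (hpos x hx).ne')
    refine (h.const_mul (b * (a + 1))⁻¹).congr_deriv ?_
    simp only [id, add_sub_cancel_right]
    field_simp
  have hlim : Filter.Tendsto (fun x => (b * (a + 1))⁻¹ * (1 + b * (x - c)) ^ (a + 1))
      Filter.atTop (nhds 0) := by
    have hlin : Filter.Tendsto (fun x => 1 + b * (x - c)) Filter.atTop Filter.atTop :=
      Filter.tendsto_atTop_add_const_left _ _
        ((Filter.tendsto_atTop_add_const_right _ (-c) Filter.tendsto_id).const_mul_atTop hb)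
    have h := (tendsto_rpow_neg_atTop (y := -(a + 1)) (by linarith)).comp hlin
    simpa [Function.comp_def] using h.const_mul (b * (a + 1))⁻¹
  rw [integral_Ioi_of_hasDerivAt_of_nonneg' hderiv
    (fun x hx => (rpow_pos_of_pos (hpos x (Set.Ioi_subset_Ici_self hx)) a).le) hlim]
  simp

/-- For the coupled exponential density with location `μ` and scale `σ`, the coupled
average uncertainty `(∫_μ^∞ f^{1+m})^{1/m}` with `m = κ/(1+κ)` equals
`(1/σ)·(1+κ)^{−(1+κ)/κ} = f(μ+σ)`. -/
theorem coupledAvgUncertainty_coupledExponential (κ σ μ : ℝ) (hκ : 0 < κ) (hσ : 0 < σ)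
    (m : ℝ) (hm : m = κ / (1 + κ)) (f : ℝ → ℝ)
    (hf : f = fun x => (1 / σ) * (1 + κ * (x - μ) / σ) ^ (-(1 + κ) / κ)) :
    (∫ x in Set.Ici μ, f x ^ (1 + m)) ^ (1 / m) = (1 / σ) * (1 + κ) ^ (-(1 + κ) / κ) ∧
      (1 / σ) * (1 + κ) ^ (-(1 + κ) / κ) = f (μ + σ) := by
  have hκ1 : 0 < 1 + κ := by linarith
  have hm0 : 0 < m := hm ▸ div_pos hκ hκ1
  constructor
  · have hpow : ∀ x ∈ Set.Ioi μ, f x ^ (1 + m) =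
        (1 / σ) ^ (1 + m) * (1 + κ / σ * (x - μ)) ^ (-(1 + 2 * κ) / κ) := by
      intro x hx
      have hbase : 0 ≤ 1 + κ / σ * (x - μ) := by
        have := mul_nonneg (div_pos hκ hσ).le (sub_nonneg.2 (Set.mem_Ioi.1 hx).le)
        linarith
      simp only [hf]
      rw [mul_div_right_comm, mul_rpow (by positivity) (rpow_nonneg hbase _), ← rpow_mul hbase]
      congr 2
      rw [hm]
      field_simp
      ring
    have hexp : -(1 + 2 * κ) / κ < -1 := by
      rw [div_lt_iff₀ hκ]
      linarith
    have hint : ∫ x in Set.Ici μ, f x ^ (1 + m) = (1 / σ) ^ m * (1 + κ)⁻¹ := by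
      rw [integral_Ici_eq_integral_Ioi, setIntegral_congr_fun measurableSet_Ioi hpow,
        integral_const_mul, integral_Ioi_one_add_mul_sub_rpow hexp (div_pos hκ hσ),
        rpow_add (by positivity), rpow_one]
      have hcoef : κ / σ * (-(1 + 2 * κ) / κ + 1) = -((1 + κ) / σ) := by
        field_simp
        ring
      rw [hcoef]
      field_simp
    rw [hint, mul_rpow (by positivity) (by positivity), ← rpow_mul (by positivity),
      mul_one_div_cancel hm0.ne', rpow_one, inv_rpow hκ1.le, ← rpow_neg hκ1.le, hm,
      one_div_div, neg_div]
  · simp only [hf, add_sub_cancel_left, mul_div_cancel_right₀ κ hσ.ne']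
end

section
/- Let κ > 0, σ > 0, μ ∈ ℝ, and let f(x) = Z^{−1}·(1 + κ·((x−μ)/σ)²)^{−(1+κ)/(2κ)} on ℝ be the coupled Gaussian density, where Z = √π·Γ(1/(2κ))·σ/(√κ·Γ((1+κ)/(2κ))). With m = 2κ/(1+κ), the coupled average uncertainty of f satisfies f_{κavg} = ( ∫_{−∞}^∞ f(x)^{1+m} dx )^{1/m} = Z^{−1}·(1+κ)^{−(1+κ)/(2κ)} = f(μ + σ); that is, the coupled average uncertainty equals the density evaluated at the location plus the scale. -/
open MeasureTheory Real

/-- The density `(1 + x²)^{-s}` has total mass `√π Γ(s - 1/2) / Γ(s)` for `s > 1/2`. -/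
theorem integral_one_add_sq_rpow_neg {s : ℝ} (hs : 1 / 2 < s) :
    ∫ x : ℝ, (1 + x ^ 2) ^ (-s) = √π * Gamma (s - 1 / 2) / Gamma s := by
  have hs0 : 0 < s := by linarith
  let F : ℝ → ℝ → ℝ := fun t x => t ^ (s - 1) * exp (-t) * exp (-t * x ^ 2)
  have inner_x : ∀ t ∈ Set.Ioi (0 : ℝ),
      ∫ x, F t x = √π * (exp (-t) * t ^ (s - 1 / 2 - 1)) := by
    intro t (ht : 0 < t)
    have hpow : t ^ (s - 1) = t ^ (s - 1 / 2 - 1) * √t := by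
      rw [sqrt_eq_rpow, ← rpow_add ht]
      ring_nf
    have hsqrt : √t ≠ 0 := by positivity
    simp only [F]
    rw [integral_const_mul, integral_gaussian, sqrt_div pi_pos.le, hpow]
    field_simp
  have inner_t : ∀ x : ℝ, ∫ t in Set.Ioi 0, F t x = (1 + x ^ 2) ^ (-s) * Gamma s := by
    intro x
    have hx : 0 < 1 + x ^ 2 := by positivity
    rw [rpow_neg hx.le, ← inv_rpow hx.le, ← one_div,
      ← integral_rpow_mul_exp_neg_mul_Ioi hs0 hx]
    refine integral_congr_ae (.of_forall fun t => ?_)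
    simp only [F]
    rw [mul_assoc, ← exp_add]
    ring_nf
  have hF : Integrable (Function.uncurry F) ((volume.restrict (Set.Ioi 0)).prod volume) := by
    have hmeas : Measurable (Function.uncurry F) := by
      simp only [F, Function.uncurry_def]
      fun_prop
    refine (integrable_prod_iff hmeas.aestronglyMeasurable).2 ⟨?_, ?_⟩
    · filter_upwards [ae_restrict_mem measurableSet_Ioi] with t ht
      exact (integrable_exp_neg_mul_sq ht).const_mul (t ^ (s - 1) * exp (-t))
    · refine ((GammaIntegral_convergent (s := s - 1 / 2) (by linarith)).const_mul √π).congr ?_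
      filter_upwards [ae_restrict_mem measurableSet_Ioi] with t ht
      rw [← inner_x t ht]
      refine integral_congr_ae (.of_forall fun x => ?_)
      have ht' : 0 < t := ht
      exact (norm_of_nonneg (by simp only [F]; positivity)).symm
  have swap := integral_integral_swap hF
  rw [setIntegral_congr_fun measurableSet_Ioi inner_x] at swap
  simp only [inner_t] at swap
  rw [integral_const_mul, integral_mul_const, ← Gamma_eq_integral (by linarith)] at swap
  rw [swap, mul_div_cancel_right₀ _ (Gamma_pos_of_pos hs0).ne']

/-- The mass of `(1 + κ ((x - μ) / σ)²)^{-s}`, by an affine change of variables. -/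
theorem integral_one_add_mul_sq_rpow_neg {κ σ s : ℝ} (μ : ℝ) (hκ : 0 < κ) (hσ : 0 < σ)
    (hs : 1 / 2 < s) :
    ∫ x : ℝ, (1 + κ * ((x - μ) / σ) ^ 2) ^ (-s) =
      σ / √κ * (√π * Gamma (s - 1 / 2) / Gamma s) := by
  have hc : 0 < σ / √κ := by positivity
  have hsub : ∀ x : ℝ, κ * ((x - μ) / σ) ^ 2 = ((x - μ) / (σ / √κ)) ^ 2 := by
    intro x
    rw [div_div_eq_mul_div, div_pow, div_pow, mul_pow, sq_sqrt hκ.le]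
    ring
  simp only [hsub]
  rw [integral_sub_right_eq_self (fun x : ℝ => (1 + (x / (σ / √κ)) ^ 2) ^ (-s)) μ,
    Measure.integral_comp_div (fun x : ℝ => (1 + x ^ 2) ^ (-s)), abs_of_pos hc, smul_eq_mul,
    integral_one_add_sq_rpow_neg hs]

/-- For the coupled Gaussian density with location `μ` and scale `σ`, the coupled
average uncertainty `(∫ f^{1+m})^{1/m}` with `m = 2κ/(1+κ)` equals
`Z⁻¹·(1+κ)^{−(1+κ)/(2κ)} = f(μ+σ)`. -/
theorem coupledAvgUncertainty_coupledGaussian (κ σ μ : ℝ) (hκ : 0 < κ) (hσ : 0 < σ)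
    (m Z : ℝ) (hm : m = 2 * κ / (1 + κ))
    (hZ : Z = Real.sqrt Real.pi * Real.Gamma (1 / (2 * κ)) * σ /
        (Real.sqrt κ * Real.Gamma ((1 + κ) / (2 * κ))))
    (f : ℝ → ℝ)
    (hf : f = fun x => Z⁻¹ * (1 + κ * ((x - μ) / σ) ^ 2) ^ (-(1 + κ) / (2 * κ))) :
    (∫ x, f x ^ (1 + m)) ^ (1 / m) = Z⁻¹ * (1 + κ) ^ (-(1 + κ) / (2 * κ)) ∧
      Z⁻¹ * (1 + κ) ^ (-(1 + κ) / (2 * κ)) = f (μ + σ) := by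
  have hκ1 : 0 < 1 + κ := by linarith
  have hm0 : 0 < m := by rw [hm]; positivity
  have hG : 0 < Gamma (1 / (2 * κ)) := Gamma_pos_of_pos (by positivity)
  have hG' : 0 < Gamma ((1 + κ) / (2 * κ)) := Gamma_pos_of_pos (by positivity)
  have hZ0 : 0 < Z := by rw [hZ]; positivity
  constructor
  · have hpow : ∀ x, f x ^ (1 + m) =
        Z⁻¹ ^ (1 + m) * (1 + κ * ((x - μ) / σ) ^ 2) ^ (-((1 + κ) / (2 * κ) + 1)) := by
      intro x
      have hx : 0 < 1 + κ * ((x - μ) / σ) ^ 2 := by positivity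
      rw [hf]
      dsimp only
      rw [mul_rpow (by positivity) (by positivity), ← rpow_mul hx.le]
      congr 2
      rw [hm]
      field_simp
    have hs : 1 / 2 < (1 + κ) / (2 * κ) + 1 := by
      have : 0 < (1 + κ) / (2 * κ) := by positivity
      linarith
    have hmass : ∫ x, f x ^ (1 + m) = Z⁻¹ ^ m * (1 + κ)⁻¹ := by
      simp only [hpow]
      rw [integral_const_mul, integral_one_add_mul_sq_rpow_neg μ hκ hσ hs,
        show (1 + κ) / (2 * κ) + 1 - 1 / 2 = 1 / (2 * κ) + 1 by field_simp; ring,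
        Gamma_add_one (by positivity), Gamma_add_one (by positivity),
        add_comm 1 m, rpow_add_one (by positivity), mul_assoc]
      congr 1
      rw [hZ]
      field_simp
    rw [hmass, mul_rpow (by positivity) (by positivity), one_div,
      rpow_rpow_inv (by positivity) hm0.ne', inv_rpow hκ1.le, ← rpow_neg hκ1.le, hm, inv_div,
      neg_div]
  · simp [hf, hσ.ne']
end

section
/- Let κ > 0, α > 0, set m = ακ/(1+κ), and let p = (p_1, …, p_N) be a probability distribution with all p_i > 0. Define the coupled probabilities P_i = p_i^{1+m}/Σ_j p_j^{1+m}. Then the two expressions for the coupled entropy agree: −ln_{−α,κ}( ( Σ_{i=1}^N p_i^{1+m} )^{1/m} ) = −Σ_{i=1}^N P_i·ln_{−α,κ}(p_i). -/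
open Real

/-- The two expressions for the coupled entropy agree:
`−ln_{−α,κ}((Σᵢ pᵢ^{1+m})^{1/m}) = −Σᵢ Pᵢ·ln_{−α,κ}(pᵢ)`. -/
theorem coupledEntropy_two_expressions (κ α : ℝ) (hκ : 0 < κ) (hα : 0 < α)
    (m : ℝ) (hm : m = α * κ / (1 + κ)) (N : ℕ) (p : Fin N → ℝ)
    (hp : ∀ i, 0 < p i) (hp1 : ∑ i, p i = 1) (P : Fin N → ℝ)
    (hP : ∀ i, P i = p i ^ (1 + m) / ∑ j, p j ^ (1 + m)) (lnmk : ℝ → ℝ)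
    (hln : lnmk = fun y => (-1 / (α * κ)) * (y ^ (-(α * κ) / (1 + κ)) - 1)) :
    -lnmk ((∑ i, p i ^ (1 + m)) ^ (1 / m)) = -∑ i, P i * lnmk (p i) := by
  have hm0 : m ≠ 0 := by rw [hm]; positivity
  have hexp : -(α * κ) / (1 + κ) = -m := by rw [hm, neg_div]
  have hne : (Finset.univ : Finset (Fin N)).Nonempty := by
    rw [Finset.nonempty_iff_ne_empty]
    intro h
    simp [h] at hp1
  set Z := ∑ j, p j ^ (1 + m) with hZ
  have hZpos : 0 < Z := Finset.sum_pos (fun i _ => rpow_pos_of_pos (hp i) _) hne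
  have hleft : (Z ^ (1 / m)) ^ (-m) = 1 / Z := by
    rw [← rpow_mul hZpos.le, show 1 / m * -m = -1 by field_simp, rpow_neg_one, one_div]
  have hPsum : ∑ i, P i = 1 := by
    simp only [hP, ← Finset.sum_div, ← hZ, div_self hZpos.ne']
  have hterm : ∀ i, P i * p i ^ (-m) = p i / Z := fun i => by
    rw [hP, div_mul_eq_mul_div, ← rpow_add (hp i), add_neg_cancel_right, rpow_one]
  have hright : ∑ i, P i * (p i ^ (-m) - 1) = 1 / Z - 1 := by
    simp only [mul_sub, mul_one, hterm, Finset.sum_sub_distrib, hPsum, ← Finset.sum_div, hp1]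
  simp only [hln, hexp, hleft, mul_left_comm (P _), ← Finset.mul_sum, hright]
end

section
/- Let κ > 0 and σ > 0, and let f(x) = (1/σ)·(1 + κ·x/σ)^{−(1+κ)/κ} for x ≥ 0 be the coupled exponential density. With m = κ/(1+κ), the coupled entropy of f has the closed form S^C_{1,κ}(f) = (1/κ)·( ( ∫_0^∞ f(x)^{1+m} dx )^{−1} − 1 ) = ( −1 + (1+κ)·σ^{κ/(1+κ)} )/κ; in particular, when σ = 1 the coupled entropy equals 1 for every κ > 0. -/
open MeasureTheory Real

theorem integral_Ioi_one_add_mul_rpow {a c : ℝ} (ha : a < -1) (hc : 0 < c) :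
    ∫ x in Set.Ioi (0 : ℝ), (1 + c * x) ^ a = -(c * (a + 1))⁻¹ := by
  have ha' : a + 1 ≠ 0 := by linarith
  have hpos : ∀ x ∈ Set.Ici (0 : ℝ), 0 < 1 + c * x := fun x hx => by
    have : 0 ≤ c * x := mul_nonneg hc.le hx
    linarith
  have hderiv : ∀ x ∈ Set.Ici (0 : ℝ), HasDerivAt
      (fun y => (c * (a + 1))⁻¹ * (1 + c * y) ^ (a + 1)) ((1 + c * x) ^ a) x := fun x hx => by
    have h := ((((hasDerivAt_id x).const_mul c).const_add 1).rpow_const (p := a + 1)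
      (Or.inl (hpos x hx).ne')).const_mul (c * (a + 1))⁻¹
    refine h.congr_deriv ?_
    rw [add_sub_cancel_right, id]
    field_simp
  have hlim : Filter.Tendsto (fun y => (c * (a + 1))⁻¹ * (1 + c * y) ^ (a + 1))
      Filter.atTop (nhds 0) := by
    have h := (tendsto_rpow_neg_atTop (y := -(a + 1)) (by linarith)).comp
      (Filter.tendsto_atTop_add_const_left _ 1 (Filter.tendsto_id.const_mul_atTop hc))
    simpa [Function.comp_def] using h.const_mul (c * (a + 1))⁻¹
  rw [integral_Ioi_of_hasDerivAt_of_nonneg' hderiv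
    (fun x hx => rpow_nonneg (hpos x (Set.Ioi_subset_Ici_self hx)).le _) hlim]
  simp

theorem integral_coupledExponential_rpow {κ σ : ℝ} (hκ : 0 < κ) (hσ : 0 < σ) :
    ∫ x in Set.Ici (0 : ℝ),
        ((1 / σ) * (1 + κ * x / σ) ^ (-(1 + κ) / κ)) ^ (1 + κ / (1 + κ)) =
      ((1 + κ) * σ ^ (κ / (1 + κ)))⁻¹ := by
  have hκ' : 0 < 1 + κ := by linarith
  have hexp : -(1 + κ) / κ * (1 + κ / (1 + κ)) = -(1 / κ + 2) := by
    field_simp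
    ring
  have hcongr : ∀ x ∈ Set.Ioi (0 : ℝ),
      ((1 / σ) * (1 + κ * x / σ) ^ (-(1 + κ) / κ)) ^ (1 + κ / (1 + κ)) =
        (σ * σ ^ (κ / (1 + κ)))⁻¹ * (1 + κ / σ * x) ^ (-(1 / κ + 2)) := fun x hx => by
    have hx' : 0 < x := hx
    have hbase : 0 ≤ 1 + κ * x / σ := by positivity
    rw [mul_rpow (by positivity) (rpow_nonneg hbase _), ← rpow_mul hbase, hexp, one_div,
      inv_rpow hσ.le, rpow_add hσ, rpow_one, mul_div_right_comm]
  have hlt : -(1 / κ + 2) < -1 := by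
    have : 0 < 1 / κ := by positivity
    linarith
  rw [integral_Ici_eq_integral_Ioi, setIntegral_congr_fun measurableSet_Ioi hcongr,
    integral_const_mul, integral_Ioi_one_add_mul_rpow hlt (by positivity),
    show κ / σ * (-(1 / κ + 2) + 1) = -((1 + κ) / σ) by field_simp; ring]
  have : σ ^ (κ / (1 + κ)) ≠ 0 := (rpow_pos_of_pos hσ _).ne'
  field_simp

/-- The coupled entropy of the coupled exponential density has the closed form
`(1/κ)·((∫_0^∞ f^{1+m})⁻¹ − 1) = (−1 + (1+κ)·σ^{κ/(1+κ)})/κ`; in particular it equals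
`1` when `σ = 1`. -/
theorem coupledEntropy_coupledExponential (κ σ : ℝ) (hκ : 0 < κ) (hσ : 0 < σ)
    (m : ℝ) (hm : m = κ / (1 + κ)) (f : ℝ → ℝ)
    (hf : f = fun x => (1 / σ) * (1 + κ * x / σ) ^ (-(1 + κ) / κ)) :
    (1 / κ) * ((∫ x in Set.Ici (0 : ℝ), f x ^ (1 + m))⁻¹ - 1) =
        (-1 + (1 + κ) * σ ^ (κ / (1 + κ))) / κ ∧
      (σ = 1 → (1 / κ) * ((∫ x in Set.Ici (0 : ℝ), f x ^ (1 + m))⁻¹ - 1) = 1) := by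
  have hclosed : (1 / κ) * ((∫ x in Set.Ici (0 : ℝ), f x ^ (1 + m))⁻¹ - 1) =
      (-1 + (1 + κ) * σ ^ (κ / (1 + κ))) / κ := by
    subst hf hm
    rw [integral_coupledExponential_rpow hκ hσ, inv_inv]
    ring
  refine ⟨hclosed, fun h => ?_⟩
  rw [hclosed, h, one_rpow]
  field_simp
  ring
end
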